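/- arXiv:2012.15366 — 3 statements merged into one kernel-verified Lean document; each statement's English description precedes it below -/
import Mathlib

section
/- Let F = ℚ(t) be the field of rational functions in one variable t over ℚ and fix γ ∈ F. Define ψ from Young diagrams to F by ψ_λ = γ^{|λ|} · ∏_{□∈λ} t^{−c(□)} / (t^{h(□)} − t^{−h(□)}). Then ψ_∅ = 1 and for every nonempty Young diagram μ one has the recursion (t − t^{−1}) · C_μ(t) · ψ_μ = γ · Σ_{λ : λ+□=μ} ψ_λ, where the sum runs over all Young diagrams λ with λ + □ = μ. (This is the algebraic content of the skein-valued recursion (◯ − P_{1,0} + a_L γ P_{0,1})Ψ = 0 for the toric brane in ℂ³, written in the basis W_λ.) -/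
open Finset

/-- The content of a cell `(i, j)` (0-indexed) of a Young diagram: `j - i`. -/
def cellContent (c : ℕ × ℕ) : ℤ := (c.2 : ℤ) - (c.1 : ℤ)

/-- The arm length of a cell: number of cells strictly to its right in its row. -/
def armLen (μ : YoungDiagram) (c : ℕ × ℕ) : ℕ := μ.rowLen c.1 - (c.2 + 1)

/-- The leg length of a cell: number of cells strictly below it in its column. -/
def legLen (μ : YoungDiagram) (c : ℕ × ℕ) : ℕ := μ.colLen c.2 - (c.1 + 1)

/-- The hook length of a cell: arm + leg + 1. -/
def hookLen (μ : YoungDiagram) (c : ℕ × ℕ) : ℕ := armLen μ c + legLen μ c + 1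

/-- `AddCell l m` means `m` is obtained from `l` by adding exactly one cell. -/
def AddCell (l m : YoungDiagram) : Prop := l.cells ⊆ m.cells ∧ m.card = l.card + 1

/-- The content of the unique cell of `m` not in `l` (when `AddCell l m`),
expressed as the sum over the one-element difference `m \ l`. -/
def newContent (l m : YoungDiagram) : ℤ := ∑ c ∈ m.cells \ l.cells, cellContent c

/-- The variable `t` of the field `ℚ(t)` of rational functions. -/
noncomputable def t : RatFunc ℚ := RatFunc.X

/-- The content polynomial `c_μ(q) = Σ_{□∈μ} q^{c(□)}` evaluated at `q = t²`,
as an element of `ℚ(t)`. -/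
noncomputable def contentPolyT (μ : YoungDiagram) : RatFunc ℚ :=
  ∑ c ∈ μ.cells, t ^ (2 * cellContent c)

/-- The hook-content solution `ψ_λ = γ^{|λ|} ∏_{□∈λ} t^{-c(□)}/(t^{h(□)} - t^{-h(□)})`. -/
noncomputable def psi (γ : RatFunc ℚ) (l : YoungDiagram) : RatFunc ℚ :=
  γ ^ l.card * ∏ c ∈ l.cells,
    t ^ (-cellContent c) / (t ^ (hookLen l c : ℤ) - t ^ (-(hookLen l c : ℤ)))

theorem t_ne : t ≠ 0 := RatFunc.X_ne_zero

theorem t_pow_ne_one (m : ℕ) (hm : m ≠ 0) : t ^ m ≠ 1 := by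
  intro h
  have h2 : algebraMap (Polynomial ℚ) (RatFunc ℚ) (Polynomial.X ^ m) = algebraMap (Polynomial ℚ) (RatFunc ℚ) 1 := by
    rw [map_pow, RatFunc.algebraMap_X, map_one]; exact h
  have h3 := RatFunc.algebraMap_injective ℚ h2
  have h4 := congrArg Polynomial.natDegree h3
  simp at h4
  exact hm h4

theorem t_zpow_ne_one (m : ℤ) (hm : m ≠ 0) : t ^ m ≠ 1 := by
  intro h
  obtain ⟨k, rfl | rfl⟩ := m.eq_nat_or_neg
  · exact t_pow_ne_one k (by omega) (by simpa using h)
  · exact t_pow_ne_one k (by omega) (by simpa using h)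

noncomputable def br (k : ℤ) : RatFunc ℚ := t ^ k - t ^ (-k)

theorem br_ne (k : ℤ) (hk : k ≠ 0) : br k ≠ 0 := by
  intro h
  apply t_zpow_ne_one (k + k) (by omega)
  have h1 : t ^ k = t ^ (-k) := sub_eq_zero.1 h
  rw [zpow_add₀ t_ne]
  nth_rewrite 1 [h1]
  rw [← zpow_add₀ t_ne]; simp

theorem br_neg (k : ℤ) : br (-k) = - br k := by simp [br]

theorem row_hook (μ : YoungDiagram) (n : ℕ) (hn : μ.colLen 0 ≤ n) (i : ℕ) (hi : i < n) (f : ℤ → RatFunc ℚ) :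
    (∏ j ∈ range (μ.rowLen i), f (hookLen μ (i, j))) *
      (∏ k ∈ Ioo i n, f (((μ.rowLen i : ℤ) - i) - ((μ.rowLen k : ℤ) - k))) =
    ∏ m ∈ Icc (1 : ℤ) (μ.rowLen i + n - 1 - i), f m := by
  have hc : ∀ j, j < μ.rowLen i → i < μ.colLen j := fun j hj =>
    YoungDiagram.mem_iff_lt_colLen.1 (YoungDiagram.mem_iff_lt_rowLen.2 hj)
  have hdual : ∀ j k, j < μ.rowLen k ↔ k < μ.colLen j := fun j k => by
    rw [← YoungDiagram.mem_iff_lt_colLen, YoungDiagram.mem_iff_lt_rowLen]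
  have hcn : ∀ j, μ.colLen j ≤ n := fun j => (μ.colLen_anti 0 j (Nat.zero_le _)).trans hn
  have hh : ∀ j, j < μ.rowLen i → (hookLen μ (i, j) : ℤ) = μ.rowLen i - j + μ.colLen j - i - 1 := by
    intro j hj
    have := hc j hj
    simp only [hookLen, armLen, legLen]
    omega
  have inj1 : Set.InjOn (fun j => (hookLen μ (i, j) : ℤ)) (range (μ.rowLen i) : Set ℕ) := by
    intro a ha b hb hab
    simp only [coe_range, Set.mem_Iio] at ha hb
    simp only [hh a ha, hh b hb] at hab
    rcases lt_trichotomy a b with h | h | h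
    · have := μ.colLen_anti a b h.le; omega
    · exact h
    · have := μ.colLen_anti b a h.le; omega
  have inj2 : Set.InjOn (fun k : ℕ => (((μ.rowLen i : ℤ) - i) - ((μ.rowLen k : ℤ) - k))) (Ioo i n : Set ℕ) := by
    intro a ha b hb hab
    simp only at hab
    rcases lt_trichotomy a b with h | h | h
    · have := μ.rowLen_anti a b h.le; omega
    · exact h
    · have := μ.rowLen_anti b a h.le; omega
  rw [← prod_image (f := f) inj1, ← prod_image (f := f) inj2, ← prod_union]
  · apply prod_congr _ (fun _ _ => rfl)
    apply eq_of_subset_of_card_le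
    · intro x hx
      rw [mem_union, mem_image, mem_image] at hx
      rw [mem_Icc]
      rcases hx with ⟨j, hj, rfl⟩ | ⟨k, hk, rfl⟩
      · rw [mem_range] at hj
        have := hc j hj
        have := hcn j
        rw [hh j hj]; omega
      · rw [mem_Ioo] at hk
        have := μ.rowLen_anti i k hk.1.le
        omega
    · rw [card_union_of_disjoint, card_image_of_injOn inj1, card_image_of_injOn inj2]
      · simp; omega
      · rw [disjoint_left]
        rintro x hx hx'
        obtain ⟨j, hj, rfl⟩ := mem_image.1 hx
        obtain ⟨k, hk, h⟩ := mem_image.1 hx'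
        rw [mem_range] at hj
        rw [hh j hj] at h
        have := hdual j k
        omega
  · rw [disjoint_left]
    rintro x hx hx'
    obtain ⟨j, hj, rfl⟩ := mem_image.1 hx
    obtain ⟨k, hk, h⟩ := mem_image.1 hx'
    rw [mem_range] at hj
    rw [hh j hj] at h
    have := hdual j k
    omega

def remCorner (μ : YoungDiagram) (p : ℕ) (hp : μ.rowLen (p+1) < μ.rowLen p) : YoungDiagram where
  cells := μ.cells.erase (p, μ.rowLen p - 1)
  isLowerSet := by
    rintro ⟨a, b⟩ ⟨c, d⟩ hle h
    simp only [coe_erase, Set.mem_sdiff, mem_coe, YoungDiagram.mem_cells, Set.mem_singleton_iff, Prod.mk.injEq] at h ⊢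
    obtain ⟨h1, h2⟩ := h
    obtain ⟨hca, hdb⟩ := Prod.mk_le_mk.1 hle
    refine ⟨μ.up_left_mem hca hdb h1, ?_⟩
    rintro ⟨rfl, rfl⟩
    apply h2
    rw [YoungDiagram.mem_iff_lt_rowLen] at h1
    rcases eq_or_lt_of_le hca with rfl | h
    · omega
    · have := μ.rowLen_anti (c+1) a h
      omega

def rem (μ : YoungDiagram) (p : ℕ) : YoungDiagram :=
  if hp : μ.rowLen (p+1) < μ.rowLen p then remCorner μ p hp else μ

theorem rem_cells (μ : YoungDiagram) (p : ℕ) (hp : μ.rowLen (p+1) < μ.rowLen p) :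
    (rem μ p).cells = μ.cells.erase (p, μ.rowLen p - 1) := by
  rw [rem, dif_pos hp]; rfl

theorem rem_rowLen (μ : YoungDiagram) (p : ℕ) (hp : μ.rowLen (p+1) < μ.rowLen p) (i : ℕ) :
    (rem μ p).rowLen i = if i = p then μ.rowLen p - 1 else μ.rowLen i := by
  apply eq_of_forall_lt_iff
  intro j
  rw [← YoungDiagram.mem_iff_lt_rowLen, ← YoungDiagram.mem_cells, rem_cells μ p hp, mem_erase,
    YoungDiagram.mem_cells, YoungDiagram.mem_iff_lt_rowLen]
  split_ifs with h
  · subst h; simp; omega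
  · simp [h]

theorem corner_mem (μ : YoungDiagram) (p : ℕ) (hp : μ.rowLen (p+1) < μ.rowLen p) :
    (p, μ.rowLen p - 1) ∈ μ.cells := by
  rw [YoungDiagram.mem_cells, YoungDiagram.mem_iff_lt_rowLen]; omega

theorem addCell_set (μ : YoungDiagram) :
    {l : YoungDiagram | AddCell l μ} =
      rem μ '' (((range (μ.colLen 0)).filter (fun p => μ.rowLen (p+1) < μ.rowLen p)) : Set ℕ) := by
  ext l
  simp only [Set.mem_ofPred_eq, Set.mem_image, mem_coe, mem_filter, mem_range]
  constructor
  · rintro ⟨hs, hcard⟩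
    have h1 : (μ.cells \ l.cells).card = 1 := by
      rw [card_sdiff_of_subset hs]; simp only [YoungDiagram.card] at hcard; omega
    obtain ⟨⟨i, j⟩, hc⟩ := card_eq_one.1 h1
    have key : ∀ x, (x ∈ μ ∧ x ∉ l) ↔ x = (i, j) := by
      intro x
      rw [← mem_singleton, ← hc, mem_sdiff]; rfl
    obtain ⟨hm, hl⟩ := (key (i,j)).2 rfl
    have hr : μ.rowLen i = j + 1 := by
      have a1 := YoungDiagram.mem_iff_lt_rowLen.1 hm
      by_contra hne
      have a2 : (i, j+1) ∈ μ := YoungDiagram.mem_iff_lt_rowLen.2 (by omega)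
      have a3 : (i, j+1) ∈ l := by
        by_contra h
        have := (key _).1 ⟨a2, h⟩
        simp at this
      exact hl (l.up_left_mem le_rfl (Nat.le_succ j) a3)
    have hp : μ.rowLen (i+1) < μ.rowLen i := by
      by_contra hne
      have a2 : (i+1, j) ∈ μ := YoungDiagram.mem_iff_lt_rowLen.2 (by omega)
      have a3 : (i+1, j) ∈ l := by
        by_contra h
        have := (key _).1 ⟨a2, h⟩
        simp at this
      exact hl (l.up_left_mem (Nat.le_succ i) le_rfl a3)
    refine ⟨i, ⟨?_, hp⟩, ?_⟩
    · exact YoungDiagram.mem_iff_lt_colLen.1 (μ.up_left_mem le_rfl (Nat.zero_le j) hm)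
    · ext1
      rw [rem_cells μ i hp, hr, Nat.add_sub_cancel]
      ext x
      rw [mem_erase]
      have := key x
      have h2 : x ∈ l.cells → x ∈ μ.cells := fun h => hs h
      simp only [YoungDiagram.mem_cells] at *
      tauto
  · rintro ⟨p, ⟨_, hp⟩, rfl⟩
    constructor
    · rw [rem_cells μ p hp]; exact erase_subset _ _
    · have := corner_mem μ p hp
      rw [YoungDiagram.card, YoungDiagram.card, rem_cells μ p hp, card_erase_of_mem this]
      have := card_pos.2 ⟨_, this⟩
      omega

theorem rem_inj (μ : YoungDiagram) :
   Set.InjOn (rem μ) (((range (μ.colLen 0)).filter (fun p => μ.rowLen (p+1) < μ.rowLen p)) : Set ℕ) := by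
  intro a ha b hb hab
  simp only [coe_filter, Set.mem_ofPred_eq] at ha hb
  have h1 := rem_rowLen μ a ha.2 a
  rw [hab, rem_rowLen μ b hb.2 a] at h1
  by_contra h
  simp [h] at h1
  omega

theorem ident1 {K : Type*} [Field K] (s : Finset ℕ) (y : ℕ → K) (hy : Set.InjOn y s) (hs : s.Nonempty)
    (q : K) (hq : 1 - q ≠ 0) :
    ∑ i ∈ s, y i * ∏ j ∈ s.erase i, ((y i - q * y j) / (y i - y j)) = ∑ i ∈ s, y i := by
  have hc : 0 < s.card := card_pos.2 hs
  set P : Polynomial K := Lagrange.nodal s (fun i => q * y i) - Lagrange.nodal s y with hPdef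
  have hP : P.degree < s.card := by
    rw [← Lagrange.degree_nodal (s := s) (v := fun i => q * y i)]
    apply Polynomial.degree_sub_lt_left
    · rw [Lagrange.degree_nodal, Lagrange.degree_nodal]
    · exact Lagrange.nodal_ne_zero
    · rw [Lagrange.nodal_monic.leadingCoeff, Lagrange.nodal_monic.leadingCoeff]
  have h := Lagrange.coeff_eq_sum hy hP
  rw [hPdef, Polynomial.coeff_sub, Lagrange.nodal_eq, Lagrange.nodal_eq,
    Polynomial.prod_X_sub_C_coeff_card_pred _ _ hc, Polynomial.prod_X_sub_C_coeff_card_pred _ _ hc,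
    ← mul_sum] at h
  apply mul_left_cancel₀ hq
  have e : (1 - q) * ∑ i ∈ s, y i = -(q * ∑ i ∈ s, y i) - -∑ i ∈ s, y i := by ring
  rw [e, h, mul_sum]
  apply sum_congr rfl
  intro i hi
  rw [Polynomial.eval_sub, ← Lagrange.nodal_eq, ← Lagrange.nodal_eq, Lagrange.eval_nodal_at_node hi,
    Lagrange.eval_nodal, ← mul_prod_erase s _ hi, prod_div_distrib]
  ring

theorem ident2 {K : Type*} [Field K] (s : Finset ℕ) (y : ℕ → K) (hy : Set.InjOn y s) (hs : s.Nonempty)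
    (hy0 : ∀ i ∈ s, y i ≠ 0) (q : K) :
    (1 - q) * ∑ i ∈ s, ∏ j ∈ s.erase i, ((y i - q * y j) / (y i - y j)) = 1 - q ^ s.card := by
  have hc : 0 < s.card := card_pos.2 hs
  set Q : Polynomial K := Lagrange.nodal s (fun i => q * y i) - Polynomial.C (q ^ s.card) * Lagrange.nodal s y with hQdef
  have hQd : Q.natDegree ≤ s.card := by
    rw [← max_self s.card]
    apply Polynomial.natDegree_sub_le_of_le
    · rw [Lagrange.natDegree_nodal]
    · exact (Polynomial.natDegree_C_mul_le _ _).trans (by rw [Lagrange.natDegree_nodal])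
  have hQ0 : Q.coeff 0 = 0 := by
    rw [Polynomial.coeff_zero_eq_eval_zero, hQdef, Polynomial.eval_sub, Polynomial.eval_mul,
      Lagrange.eval_nodal, Lagrange.eval_nodal, Polynomial.eval_C]
    simp only [zero_sub, ← mul_neg, prod_mul_distrib, prod_const, sub_self]
  have hX := Polynomial.divX_mul_X_add Q
  rw [hQ0, map_zero, add_zero] at hX
  have hP : Q.divX.degree < s.card := by
    apply lt_of_le_of_lt Polynomial.degree_le_natDegree
    rw [Polynomial.natDegree_divX_eq_natDegree_tsub_one]
    norm_cast; omega
  have h := Lagrange.coeff_eq_sum hy hP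
  have hl : ∀ v : ℕ → K, (Lagrange.nodal s v).coeff s.card = 1 := fun v => by
    have := (Lagrange.nodal_monic (s := s) (v := v)).coeff_natDegree
    rwa [Lagrange.natDegree_nodal] at this
  rw [Polynomial.coeff_divX, Nat.sub_add_cancel hc, hQdef, Polynomial.coeff_sub,
    Polynomial.coeff_C_mul, hl, hl, mul_one, ← hQdef] at h
  rw [h, mul_sum]
  apply sum_congr rfl
  intro i hi
  have h2 := congrArg (Polynomial.eval (y i)) hX
  rw [Polynomial.eval_mul, Polynomial.eval_X, hQdef, Polynomial.eval_sub, Polynomial.eval_mul,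
    Lagrange.eval_nodal_at_node hi, mul_zero, sub_zero, ← hQdef,
    Lagrange.eval_nodal, ← mul_prod_erase s _ hi] at h2
  have h3 : Polynomial.eval (y i) Q.divX = (1 - q) * ∏ x ∈ s.erase i, (y i - q * y x) := by
    apply mul_right_cancel₀ (hy0 i hi)
    rw [h2]; ring
  rw [h3, prod_div_distrib]
  ring

noncomputable def DD (n : ℕ) (l : ℕ → ℤ) : RatFunc ℚ := ∏ i ∈ range n, ∏ k ∈ Ioo i n, br (l i - l k)

theorem DD_split (n : ℕ) (l : ℕ → ℤ) (p : ℕ) (hp : p < n) :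
    DD n l = (∏ i ∈ (range n).erase p, ∏ k ∈ (range n).erase p, if i < k then br (l i - l k) else 1) *
      (∏ k ∈ (range n).erase p, if p < k then 1 else -1) * ∏ k ∈ (range n).erase p, br (l p - l k) := by
  have h1 : DD n l = ∏ i ∈ range n, ∏ k ∈ range n, if i < k then br (l i - l k) else 1 := by
    apply prod_congr rfl
    intro i _
    rw [← prod_filter]
    apply prod_congr _ (fun _ _ => rfl)
    ext k; simp; tauto
  have hp' := mem_range.2 hp
  rw [h1, ← mul_prod_erase _ _ hp', ← mul_prod_erase _ _ hp']
  have h2 : ∀ i ∈ (range n).erase p, (∏ k ∈ range n, if i < k then br (l i - l k) else 1) =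
      (if i < p then br (l i - l p) else 1) * ∏ k ∈ (range n).erase p, if i < k then br (l i - l k) else 1 :=
    fun i _ => (mul_prod_erase _ _ hp').symm
  rw [prod_congr rfl h2, prod_mul_distrib, if_neg (lt_irrefl p), one_mul, mul_comm, mul_assoc, mul_comm, mul_assoc,
    mul_assoc]
  congr 1
  rw [← prod_mul_distrib, ← prod_mul_distrib]
  apply prod_congr rfl
  intro k hk
  have hk := ne_of_mem_erase hk
  rcases lt_or_gt_of_ne hk with h | h
  · rw [if_pos h, if_neg (by omega), if_neg (by omega), ← neg_sub, br_neg]; ring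
  · rw [if_pos h, if_pos h, if_neg (by omega)]; ring

theorem DD_rem (n : ℕ) (l l' : ℕ → ℤ) (p : ℕ) (hp : p < n) (h1 : l' p = l p - 1) (h2 : ∀ k, k ≠ p → l' k = l k)
    (hne : ∀ k ∈ (range n).erase p, l p ≠ l k) :
    DD n l' = DD n l * ∏ k ∈ (range n).erase p, (br (l p - l k - 1) / br (l p - l k)) := by
  rw [DD_split n l p hp, DD_split n l' p hp, prod_div_distrib]
  have e1 : (∏ k ∈ (range n).erase p, br (l' p - l' k)) = ∏ k ∈ (range n).erase p, br (l p - l k - 1) := by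
    apply prod_congr rfl
    intro k hk
    rw [h1, h2 k (ne_of_mem_erase hk)]; congr 1; ring
  have e2 : (∏ i ∈ (range n).erase p, ∏ k ∈ (range n).erase p, if i < k then br (l' i - l' k) else 1)
    = (∏ i ∈ (range n).erase p, ∏ k ∈ (range n).erase p, if i < k then br (l i - l k) else 1) := by
    apply prod_congr rfl
    intro i hi
    apply prod_congr rfl
    intro k hk
    rw [h2 k (ne_of_mem_erase hk), h2 i (ne_of_mem_erase hi)]
  rw [e1, e2]
  have : (∏ k ∈ (range n).erase p, br (l p - l k)) ≠ 0 :=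
    prod_ne_zero_iff.2 fun k hk => br_ne _ (sub_ne_zero.2 (hne k hk))
  field_simp

noncomputable def RR (n i m : ℕ) : RatFunc ℚ :=
  (∏ j ∈ range m, t ^ (-((j : ℤ) - i))) / ∏ x ∈ Icc (1 : ℤ) (m + n - 1 - i), br x

theorem RR_succ (n i m : ℕ) (hi : i < n) :
    RR n i m = RR n i (m + 1) * (t ^ ((m : ℤ) - i) * br (m + n - i)) := by
  have h : Icc (1 : ℤ) ((m + 1 : ℕ) + n - 1 - i) = insert ((m : ℤ) + n - i) (Icc (1 : ℤ) (m + n - 1 - i)) := by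
    ext x; simp only [mem_Icc, mem_insert]; push_cast; omega
  rw [RR, RR, h, prod_insert (by simp), prod_range_succ, zpow_neg]
  have h1 := br_ne ((m : ℤ) + n - i) (by omega)
  have h2 : t ^ ((m : ℤ) - i) ≠ 0 := zpow_ne_zero _ t_ne
  field_simp

theorem cells_prod (μ : YoungDiagram) (n : ℕ) (hn : μ.colLen 0 ≤ n) (p : ℕ × ℕ) :
    p ∈ μ.cells ↔ p.1 ∈ range n ∧ p.2 ∈ range (μ.rowLen p.1) := by
  obtain ⟨i, j⟩ := p
  rw [YoungDiagram.mem_cells, mem_range, mem_range, ← YoungDiagram.mem_iff_lt_rowLen]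
  refine ⟨fun h => ⟨?_, h⟩, fun h => h.2⟩
  exact (YoungDiagram.mem_iff_lt_colLen.1 (μ.up_left_mem le_rfl (Nat.zero_le j) h)).trans_le hn

theorem l_lt (μ : YoungDiagram) (i k : ℕ) (h : i < k) : (μ.rowLen k : ℤ) - k < (μ.rowLen i : ℤ) - i := by
  have := μ.rowLen_anti i k h.le
  omega

theorem psi_formula (γ : RatFunc ℚ) (μ : YoungDiagram) (n : ℕ) (hn : μ.colLen 0 ≤ n) :
    psi γ μ = γ ^ μ.card * ((∏ i ∈ range n, RR n i (μ.rowLen i)) * DD n (fun i => (μ.rowLen i : ℤ) - i)) := by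
  rw [psi, prod_finset_product _ (range n) (fun i => range (μ.rowLen i)) (cells_prod μ n hn), DD, ← prod_mul_distrib]
  congr 1
  apply prod_congr rfl
  intro i hi
  have h := row_hook μ n hn i (mem_range.1 hi) br
  rw [RR, ← h, prod_div_distrib]
  have hV : (∏ k ∈ Ioo i n, br (((μ.rowLen i : ℤ) - i) - ((μ.rowLen k : ℤ) - k))) ≠ 0 :=
    prod_ne_zero_iff.2 fun k hk => br_ne _ (sub_ne_zero.2 (l_lt μ i k (mem_Ioo.1 hk).1).ne')
  have hH : (∏ j ∈ range (μ.rowLen i), br (hookLen μ (i, j))) ≠ 0 :=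
    prod_ne_zero_iff.2 fun k hk => br_ne _ (by simp [hookLen]; omega)
  simp only [cellContent]
  change _ / (∏ j ∈ range (μ.rowLen i), br (hookLen μ (i, j))) = _
  field_simp

noncomputable def ff (μ : YoungDiagram) (n p : ℕ) : RatFunc ℚ :=
  t ^ ((μ.rowLen p : ℤ) - p - 1) * br (μ.rowLen p + n - p - 1) *
    ∏ k ∈ (range n).erase p, (br (((μ.rowLen p : ℤ) - p) - ((μ.rowLen k : ℤ) - k) - 1) /
      br (((μ.rowLen p : ℤ) - p) - ((μ.rowLen k : ℤ) - k)))

theorem l_ne (μ : YoungDiagram) (i k : ℕ) (h : k ≠ i) : (μ.rowLen i : ℤ) - i ≠ (μ.rowLen k : ℤ) - k := by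
  rcases lt_or_gt_of_ne h with h | h
  · exact (l_lt μ k i h).ne
  · exact (l_lt μ i k h).ne'

theorem psi_rem (γ : RatFunc ℚ) (μ : YoungDiagram) (p : ℕ) (hpn : p < μ.colLen 0)
    (hp : μ.rowLen (p+1) < μ.rowLen p) :
    γ * psi γ (rem μ p) = psi γ μ * ff μ (μ.colLen 0) p := by
  have hn : (rem μ p).colLen 0 ≤ μ.colLen 0 := by
    by_contra! h
    have h1 := YoungDiagram.mem_iff_lt_colLen.2 h
    rw [← YoungDiagram.mem_cells, rem_cells μ p hp] at h1
    exact lt_irrefl _ (YoungDiagram.mem_iff_lt_colLen.1 (mem_of_mem_erase h1))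
  rw [psi_formula γ _ _ hn, psi_formula γ μ _ le_rfl]
  set n := μ.colLen 0
  have hcard : μ.card = (rem μ p).card + 1 := by
    have := corner_mem μ p hp
    rw [YoungDiagram.card, YoungDiagram.card, rem_cells μ p hp, card_erase_of_mem this]
    have := card_pos.2 ⟨_, this⟩
    omega
  have hr := rem_rowLen μ p hp
  rw [DD_rem n (fun i => (μ.rowLen i : ℤ) - i) _ p hpn
    (by simp only [hr, if_true]; omega) (by intro k hk; simp only [hr, if_neg hk])
    (fun k hk => l_ne μ p k (ne_of_mem_erase hk)), hcard]
  have hp' := mem_range.2 hpn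
  rw [← mul_prod_erase _ _ hp', ← mul_prod_erase (range n) (fun i => RR n i (μ.rowLen i)) hp']
  have e : ∏ i ∈ (range n).erase p, RR n i ((rem μ p).rowLen i) = ∏ i ∈ (range n).erase p, RR n i (μ.rowLen i) :=
    prod_congr rfl fun k hk => by rw [hr, if_neg (ne_of_mem_erase hk)]
  obtain ⟨m, hm⟩ : ∃ m, μ.rowLen p = m + 1 := ⟨μ.rowLen p - 1, by omega⟩
  have e2 : RR n p ((rem μ p).rowLen p) = RR n p (μ.rowLen p) * (t ^ ((μ.rowLen p : ℤ) - p - 1) * br (μ.rowLen p + n - p - 1)) := by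
    rw [hr, if_pos rfl, hm, Nat.add_sub_cancel, RR_succ n p m hpn]
    congr 3
    · push_cast; ring
    · push_cast; ring
  rw [e, e2, ff]
  ring

theorem ff_zero (μ : YoungDiagram) (p : ℕ) (hpn : p < μ.colLen 0)
    (hp : ¬ μ.rowLen (p+1) < μ.rowLen p) : ff μ (μ.colLen 0) p = 0 := by
  have h0 := YoungDiagram.mem_iff_lt_rowLen.1 (YoungDiagram.mem_iff_lt_colLen.2 hpn)
  have h1 : p + 1 < μ.colLen 0 := by
    rw [← YoungDiagram.mem_iff_lt_colLen, YoungDiagram.mem_iff_lt_rowLen]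
    omega
  have h2 := μ.rowLen_anti p (p+1) (Nat.le_succ p)
  rw [ff, prod_eq_zero (i := p + 1)]
  · simp
  · simp [h1]
  · have : ((μ.rowLen p : ℤ) - p) - ((μ.rowLen (p+1) : ℤ) - (p+1 : ℕ)) - 1 = 0 := by omega
    rw [this]; simp [br]

theorem ff_eq (μ : YoungDiagram) (n p : ℕ) (hp : p < n) :
    ff μ n p = (t⁻¹ * t ^ (2 * ((μ.rowLen p : ℤ) - p)) - t ^ (1 - 2 * (n : ℤ))) *
      ∏ k ∈ (range n).erase p, ((t ^ (2 * ((μ.rowLen p : ℤ) - p)) - t ^ 2 * t ^ (2 * ((μ.rowLen k : ℤ) - k))) /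
        (t ^ (2 * ((μ.rowLen p : ℤ) - p)) - t ^ (2 * ((μ.rowLen k : ℤ) - k)))) := by
  have key : ∀ a b : ℤ, a ≠ b → br (a - b - 1) / br (a - b) =
      t⁻¹ * ((t ^ (2 * a) - t ^ 2 * t ^ (2 * b)) / (t ^ (2 * a) - t ^ (2 * b))) := by
    intro a b hab
    have e1 : t ^ (2 * a) - t ^ (2 * b) = t ^ (a + b) * br (a - b) := by
      rw [br, mul_sub, ← zpow_add₀ t_ne, ← zpow_add₀ t_ne]
      congr 2 <;> ring
    have e2 : t ^ (2 * a) - t ^ 2 * t ^ (2 * b) = t ^ (a + b) * t * br (a - b - 1) := by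
      rw [br, mul_sub, ← zpow_natCast, ← zpow_add₀ t_ne, ← zpow_add_one₀ t_ne, ← zpow_add₀ t_ne, ← zpow_add₀ t_ne]
      congr 2 <;> (push_cast; ring)
    rw [e1, e2]
    have h1 := br_ne (a - b) (sub_ne_zero.2 hab)
    have h2 : t ^ (a + b) ≠ 0 := zpow_ne_zero _ t_ne
    have h3 := t_ne
    field_simp
  rw [ff, prod_congr rfl (fun k hk => key _ _ (l_ne μ p k (ne_of_mem_erase hk))), prod_mul_distrib, prod_const,
    card_erase_of_mem (mem_range.2 hp), card_range, ← mul_assoc]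
  congr 1
  rw [br, ← zpow_natCast, ← zpow_neg_one, ← zpow_mul, mul_sub, sub_mul, ← zpow_add₀ t_ne, ← zpow_add₀ t_ne, ← zpow_add₀ t_ne, ← zpow_add₀ t_ne, ← zpow_add₀ t_ne]
  congr 2 <;> (push_cast [Nat.cast_sub (show 1 ≤ n by omega)]; ring)

theorem content_row (i : ℤ) (m : ℕ) :
    (t - t⁻¹) * ∑ j ∈ range m, t ^ (2 * ((j : ℤ) - i)) = t⁻¹ * t ^ (2 * ((m : ℤ) - i)) - t⁻¹ * t ^ (-(2 * i)) := by
  induction m with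
  | zero => simp
  | succ m ih =>
    rw [sum_range_succ, mul_add, ih]
    have : t ^ (2 * (((m + 1 : ℕ) : ℤ) - i)) = t ^ (2 * ((m : ℤ) - i)) * t ^ 2 := by
      rw [← zpow_natCast, ← zpow_add₀ t_ne]; congr 1; push_cast; ring
    rw [this]
    have h3 := t_ne
    field_simp
    ring

theorem geo (n : ℕ) : (1 - t ^ 2) * ∑ i ∈ range n, t⁻¹ * t ^ (-(2 * (i : ℤ))) =
    t ^ (1 - 2 * (n : ℤ)) * (1 - (t ^ 2) ^ n) := by
  have h0 : ∀ n : ℕ, t ^ (1 - 2 * (n : ℤ)) * (1 - (t ^ 2) ^ n) = t ^ (1 - 2 * (n : ℤ)) - t := by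
    intro n
    rw [mul_sub, mul_one, ← pow_mul, ← zpow_natCast, ← zpow_add₀ t_ne]
    congr 1
    have : (1 - 2 * (n : ℤ) + (2 * n : ℕ)) = 1 := by push_cast; ring
    rw [this, zpow_one]
  rw [h0]
  induction n with
  | zero => simp
  | succ n ih =>
    rw [sum_range_succ, mul_add, ih]
    have e1 : t ^ (1 - 2 * (n : ℤ)) = t ^ (-(2 * (n : ℤ))) * t := by
      rw [← zpow_add_one₀ t_ne]; congr 1; ring
    have e2 : t ^ (1 - 2 * ((n + 1 : ℕ) : ℤ)) = t ^ (-(2 * (n : ℤ))) * t⁻¹ := by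
      rw [← zpow_sub_one₀ t_ne]; congr 1; push_cast; ring
    rw [e1, e2]
    have h3 := t_ne
    field_simp
    ring

theorem sum_ff (μ : YoungDiagram) (n : ℕ) (hn : μ.colLen 0 ≤ n) (h0 : 0 < n) :
    (t - t⁻¹) * contentPolyT μ = ∑ p ∈ range n, ff μ n p := by
  have hq : (1 : RatFunc ℚ) - t ^ 2 ≠ 0 := sub_ne_zero.2 (t_pow_ne_one 2 (by norm_num)).symm
  have hs : (range n).Nonempty := ⟨0, mem_range.2 h0⟩
  have hy : Set.InjOn (fun i : ℕ => t ^ (2 * ((μ.rowLen i : ℤ) - i))) (range n : Set ℕ) := by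
    intro a _ b _ hab
    by_contra hne
    have h1 := l_ne μ a b (Ne.symm hne)
    apply t_zpow_ne_one (2 * ((μ.rowLen a : ℤ) - a) - 2 * ((μ.rowLen b : ℤ) - b)) (by omega)
    rw [zpow_sub₀ t_ne]
    simp only at hab
    rw [hab, div_self (zpow_ne_zero _ t_ne)]
  have i1 := ident1 (range n) _ hy hs (t ^ 2) hq
  have i2 := ident2 (range n) _ hy hs (fun i _ => zpow_ne_zero _ t_ne) (t ^ 2)
  rw [card_range] at i2
  rw [contentPolyT, sum_finset_product _ (range n) (fun i => range (μ.rowLen i)) (cells_prod μ n hn), mul_sum]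
  simp only [cellContent]
  rw [sum_congr rfl (fun (i : ℕ) _ => content_row (i : ℤ) (μ.rowLen i)), sum_sub_distrib,
    sum_congr rfl (fun p hp => ff_eq μ n p (mem_range.1 hp))]
  simp only [sub_mul, sum_sub_distrib, mul_assoc]
  rw [← mul_sum, ← mul_sum, ← mul_sum, i1, ← mul_sum]
  congr 1
  apply mul_left_cancel₀ hq
  have g := geo n
  rw [← mul_sum] at g
  rw [g, ← i2]
  ring

/-- The hook-content function `ψ` solves the skein-valued recursion for the toric
brane in `ℂ³`, written in the basis `W_λ`:  `ψ_∅ = 1` and for every nonempty `μ`,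
`(t - t⁻¹)·C_μ(t)·ψ_μ = γ·Σ_{λ+□=μ} ψ_λ`. -/
theorem toric_brane_recursion_solution (γ : RatFunc ℚ) :
    psi γ ⊥ = 1 ∧
    ∀ μ : YoungDiagram, μ.cells.Nonempty →
      (t - t⁻¹) * contentPolyT μ * psi γ μ =
        γ * ∑ᶠ l ∈ {l : YoungDiagram | AddCell l μ}, psi γ l := by
  refine ⟨by simp [psi, YoungDiagram.card], ?_⟩
  intro μ hμ
  have h0 : 0 < μ.colLen 0 := by
    obtain ⟨⟨i, j⟩, h⟩ := hμ
    exact YoungDiagram.mem_iff_lt_colLen.1 (μ.up_left_mem (Nat.zero_le i) (Nat.zero_le j) h)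
  rw [sum_ff μ _ le_rfl h0, addCell_set, finsum_mem_image (rem_inj μ), finsum_mem_coe_finset, mul_sum,
    sum_mul, sum_filter]
  apply sum_congr rfl
  intro p hp
  have hp := mem_range.1 hp
  split_ifs with h
  · rw [psi_rem γ μ p hp h, mul_comm]
  · rw [ff_zero μ p hp h, zero_mul]
end

section
/- For every Young diagram λ, the Laurent polynomial t^{−Σ_{□∈λ} c(□)} · ∏_{□∈λ} t^{−2 l(□)} · (1 + t² + t⁴ + ⋯ + t^{2(h(□)−1)}) in ℤ[t, t^{−1}] is invariant under the substitution t ↦ t^{−1}. (This is the statement that h_λ(q) · ∏_{□∈λ} q^{−c(□)/2} is symmetric under q → q^{−1}, written in the variable t = q^{1/2}, where h_λ(q) = ∏_{□∈λ} q^{−l(□)}[h(□)]_q is the hook polynomial.) -/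
open Finset

open LaurentPolynomial in
theorem aux_sum (n : ℕ) :
    invert (∑ k ∈ Finset.range (n + 1), (T (2 * (k : ℤ)) : LaurentPolynomial ℤ)) =
      T (-2 * (n : ℤ)) * ∑ k ∈ Finset.range (n + 1), T (2 * (k : ℤ)) := by
  rw [map_sum, Finset.mul_sum, ← Finset.sum_range_reflect]
  refine Finset.sum_congr rfl fun k hk => ?_
  have hk' : k ≤ n := by
    have := Finset.mem_range.mp hk
    omega
  rw [invert_T, ← T_add]
  congr 1
  have : ((n + 1 - 1 - k : ℕ) : ℤ) = n - k := by omega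
  rw [this]
  ring

theorem aux_arm (l : YoungDiagram) :
    ∑ c ∈ l.cells, (armLen l c : ℤ) = ∑ c ∈ l.cells, (c.2 : ℤ) := by
  refine Finset.sum_nbij' (fun c => (c.1, armLen l c)) (fun c => (c.1, armLen l c)) ?_ ?_ ?_ ?_ ?_
  all_goals
    rintro ⟨i, j⟩ h
    have h' := YoungDiagram.mem_iff_lt_rowLen.mp ((YoungDiagram.mem_cells _).mp h)
    simp only [armLen, YoungDiagram.mem_cells, YoungDiagram.mem_iff_lt_rowLen, Prod.mk.injEq,
      true_and] <;> omega

theorem aux_leg (l : YoungDiagram) :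
    ∑ c ∈ l.cells, (legLen l c : ℤ) = ∑ c ∈ l.cells, (c.1 : ℤ) := by
  refine Finset.sum_nbij' (fun c => (legLen l c, c.2)) (fun c => (legLen l c, c.2)) ?_ ?_ ?_ ?_ ?_
  all_goals
    rintro ⟨i, j⟩ h
    have h' := YoungDiagram.mem_iff_lt_colLen.mp ((YoungDiagram.mem_cells _).mp h)
    simp only [legLen, YoungDiagram.mem_cells, YoungDiagram.mem_iff_lt_colLen, Prod.mk.injEq,
      and_true] <;> omega

open LaurentPolynomial in
theorem aux_prod (s : Finset (ℕ × ℕ)) (f : ℕ × ℕ → ℤ) :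
    ∏ c ∈ s, (T (f c) : LaurentPolynomial ℤ) = T (∑ c ∈ s, f c) := by
  classical
  induction s using Finset.induction_on with
  | empty => simp
  | insert a s ha ih => rw [Finset.prod_insert ha, Finset.sum_insert ha, ih, T_add]

/-- Written in the variable `t = q^{1/2}`, the Laurent polynomial
`t^{-Σ c(□)} · ∏_{□∈λ} t^{-2l(□)}(1 + t² + ⋯ + t^{2(h(□)-1)})`, i.e.
`h_λ(q)·∏ q^{-c(□)/2}`, is invariant under `t ↦ t⁻¹`. -/
theorem hook_poly_symmetric (l : YoungDiagram) :
    LaurentPolynomial.invert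
      ((LaurentPolynomial.T (-∑ c ∈ l.cells, cellContent c) : LaurentPolynomial ℤ) *
        ∏ c ∈ l.cells, LaurentPolynomial.T (-2 * (legLen l c : ℤ)) *
          ∑ k ∈ Finset.range (hookLen l c), LaurentPolynomial.T (2 * (k : ℤ))) =
    (LaurentPolynomial.T (-∑ c ∈ l.cells, cellContent c) : LaurentPolynomial ℤ) *
      ∏ c ∈ l.cells, LaurentPolynomial.T (-2 * (legLen l c : ℤ)) *
        ∑ k ∈ Finset.range (hookLen l c), LaurentPolynomial.T (2 * (k : ℤ)) := by
  have key : ∀ c ∈ l.cells, LaurentPolynomial.invert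
      ((LaurentPolynomial.T (-2 * (legLen l c : ℤ)) : LaurentPolynomial ℤ) *
        ∑ k ∈ Finset.range (hookLen l c), LaurentPolynomial.T (2 * (k : ℤ))) =
      LaurentPolynomial.T (2 * ((legLen l c : ℤ) - armLen l c)) *
      (LaurentPolynomial.T (-2 * (legLen l c : ℤ)) *
        ∑ k ∈ Finset.range (hookLen l c), LaurentPolynomial.T (2 * (k : ℤ))) := by
    intro c _
    rw [map_mul, hookLen, aux_sum, LaurentPolynomial.invert_T, ← mul_assoc, ← mul_assoc,
      ← LaurentPolynomial.T_add, ← LaurentPolynomial.T_add]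
    congr 2
    push_cast
    ring
  rw [map_mul, map_prod, Finset.prod_congr rfl key, Finset.prod_mul_distrib, aux_prod,
    LaurentPolynomial.invert_T, ← mul_assoc, ← LaurentPolynomial.T_add]
  congr 2
  rw [← Finset.mul_sum, Finset.sum_sub_distrib, aux_arm, aux_leg]
  simp only [cellContent, Finset.sum_sub_distrib]
  ring
end

section
/- Let F = ℚ(a, t) be the field of rational functions in two variables a, t over ℚ and fix γ ∈ F. Define ψ from Young diagrams to F by ψ_λ = γ^{|λ|} · ∏_{□∈λ} (a t^{−c(□)} − a^{−1} t^{c(□)}) / (t^{h(□)} − t^{−h(□)}). Then ψ_∅ = 1 and for every nonempty Young diagram μ, (t − t^{−1}) · C_μ(t) · ψ_μ = γ · Σ_{λ : λ+□=μ} (a − a^{−1} t^{2 c(μ∖λ)}) · ψ_λ, where c(μ∖λ) denotes the content of the unique cell of μ not in λ. (This is the algebraic content of the skein-valued recursion (◯ − P_{1,0} + γ(a_L a P_{0,1} − a^{−1} P_{1,1}))Ψ = 0 for the unknot conormal, written in the basis W_λ.) -/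
open Finset

/-- The field `ℚ(a,t)` of rational functions in two variables over `ℚ`, realized as
rational functions in `t` over the field `ℚ(a)`. -/
abbrev F2 : Type := RatFunc (RatFunc ℚ)

/-- The variable `a` of `ℚ(a,t)`. -/
noncomputable def va : F2 := RatFunc.C RatFunc.X

/-- The variable `t` of `ℚ(a,t)`. -/
noncomputable def vt : F2 := RatFunc.X

/-- The content polynomial `c_μ(q) = Σ_{□∈μ} q^{c(□)}` evaluated at `q = t²`,
as an element of `ℚ(a,t)`. -/
noncomputable def contentPolyT2 (μ : YoungDiagram) : F2 :=
  ∑ c ∈ μ.cells, vt ^ (2 * cellContent c)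

/-- The hook-content solution
`ψ_λ = γ^{|λ|} ∏_{□∈λ} (a t^{-c(□)} - a⁻¹ t^{c(□)})/(t^{h(□)} - t^{-h(□)})`
for the unknot conormal. -/
noncomputable def psiUnknot (γ : F2) (l : YoungDiagram) : F2 :=
  γ ^ l.card * ∏ c ∈ l.cells,
    (va * vt ^ (-cellContent c) - va⁻¹ * vt ^ cellContent c) /
      (vt ^ (hookLen l c : ℤ) - vt ^ (-(hookLen l c : ℤ)))


def brk {K : Type*} [Field K] (t : K) (k : ℤ) : K := t ^ k - t ^ (-k)

lemma brk_neg {K : Type*} [Field K] (t : K) (k : ℤ) : brk t (-k) = - brk t k := by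
  simp [brk]

/-- identity B -/
lemma hl_B {K : Type*} [Field K] (n : ℕ) (X : ℕ → K) (q : K) (hq : q ≠ 1)
    (hX : Set.InjOn X (range n)) :
    ∑ i ∈ range n, X i * ∏ j ∈ (range n).erase i, (X i - q * X j) / (X i - X j)
      = ∑ i ∈ range n, X i := by
  have h1q : (1 - q) ≠ 0 := sub_ne_zero.2 (Ne.symm hq)
  rcases Nat.eq_zero_or_pos n with rfl | hn
  · simp
  set P : Polynomial K := (∏ j ∈ range n, (Polynomial.X - Polynomial.C (q * X j)))
     - ∏ j ∈ range n, (Polynomial.X - Polynomial.C (X j)) with hP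
  have hdeg : P.degree < n := by
    have := Polynomial.degree_sub_lt_left (p := ∏ j ∈ range n, (Polynomial.X - Polynomial.C (q * X j)))
      (q := ∏ j ∈ range n, (Polynomial.X - Polynomial.C (X j)))
      (by simp [Polynomial.degree_prod, -map_mul])
      (Polynomial.Monic.ne_zero (Polynomial.monic_prod_of_monic _ _ fun i _ => Polynomial.monic_X_sub_C _))
      (by rw [(Polynomial.monic_prod_of_monic _ _ fun i _ => Polynomial.monic_X_sub_C _).leadingCoeff, 
        (Polynomial.monic_prod_of_monic _ _ fun i _ => Polynomial.monic_X_sub_C _).leadingCoeff])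
    simpa [Polynomial.degree_prod, -map_mul] using this
  have hc : P.coeff (n - 1) = (1 - q) * ∑ i ∈ range n, X i := by
    have h1 := Polynomial.prod_X_sub_C_coeff_card_pred (range n) (fun j => q * X j) (by simpa using hn)
    have h2 := Polynomial.prod_X_sub_C_coeff_card_pred (range n) X (by simpa using hn)
    rw [card_range] at h1 h2
    rw [hP, Polynomial.coeff_sub, h1, h2, ← mul_sum]
    ring
  have key := Lagrange.coeff_eq_sum hX (P := P) (by rw [card_range]; exact hdeg)
  rw [card_range, hc] at key
  apply mul_left_cancel₀ h1q
  rw [key, mul_sum]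
  refine sum_congr rfl fun i hi => ?_
  have : P.eval (X i) = (1 - q) * X i * ∏ j ∈ (range n).erase i, (X i - q * X j) := by
    rw [hP, Polynomial.eval_sub, Polynomial.eval_prod, Polynomial.eval_prod,
      ← mul_prod_erase _ _ hi, ← mul_prod_erase _ _ hi]
    simp only [Polynomial.eval_sub, Polynomial.eval_X, Polynomial.eval_C]
    ring
  rw [this, prod_div_distrib]
  ring

lemma hl_A {K : Type*} [Field K] (n : ℕ) (X : ℕ → K) (q : K) (hq : q ≠ 1)
    (hX : Set.InjOn X (range n)) (h0 : ∀ i, X i ≠ 0) :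
    ∑ i ∈ range n, ∏ j ∈ (range n).erase i, (X i - q * X j) / (X i - X j)
      = ∑ i ∈ range n, q ^ i := by
  have h1q : (1 - q) ≠ 0 := sub_ne_zero.2 (Ne.symm hq)
  set P : Polynomial K := (∏ j ∈ range n, (Polynomial.X - Polynomial.C (q * X j))) with hP
  have hm : P.Monic := Polynomial.monic_prod_of_monic _ _ fun i _ => Polynomial.monic_X_sub_C _
  let Y : ℕ → K := fun i => if i = n then 0 else X i
  have hYn : Y n = 0 := by simp [Y]
  have hYi : ∀ i ∈ range n, Y i = X i := fun i hi => by
    have := (mem_range.1 hi).ne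
    simp [Y, this]
  have hY : Set.InjOn Y (range (n+1)) := by
    intro i hi j hj h
    simp only [coe_range, Set.mem_Iio] at hi hj
    by_cases hin : i = n <;> by_cases hjn : j = n
    · omega
    · simp [Y, hin, hjn] at h; exact absurd h.symm (h0 j)
    · simp [Y, hin, hjn] at h; exact absurd h (h0 i)
    · simp [Y, hin, hjn] at h
      exact hX (by simp; omega) (by simp; omega) h
  have hdeg : P.degree = n := by simp [hP, Polynomial.degree_prod, -map_mul]
  have key := Lagrange.leadingCoeff_eq_sum hY (P := P) (by rw [card_range, hdeg]; simp)
  rw [hm.leadingCoeff, sum_range_succ] at key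
  have e1 : Polynomial.eval (Y n) P / ∏ j ∈ (range (n+1)).erase n, (Y n - Y j) = q ^ n := by
    have : (range (n+1)).erase n = range n := by ext x; simp; omega
    rw [this, hYn, hP, Polynomial.eval_prod, ← prod_div_distrib]
    rw [prod_congr rfl (g := fun _ => q)]
    · simp
    · intro j hj
      rw [hYi j hj]
      have := h0 j
      simp; field_simp
  rw [e1] at key
  apply mul_left_cancel₀ h1q
  rw [mul_neg_geom_sum, ← eq_sub_iff_add_eq.2 key.symm, mul_sum]
  refine sum_congr rfl fun i hi => ?_
  have hi' := mem_range.1 hi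
  have : P.eval (X i) = (1 - q) * X i * ∏ j ∈ (range n).erase i, (X i - q * X j) := by
    rw [hP, Polynomial.eval_prod, ← mul_prod_erase _ _ hi]
    simp only [Polynomial.eval_sub, Polynomial.eval_X, Polynomial.eval_C]
    ring
  have e2 : ∏ j ∈ (range (n+1)).erase i, (X i - Y j) 
      = X i * ∏ j ∈ (range n).erase i, (X i - X j) := by
    have : (range (n+1)).erase i = insert n ((range n).erase i) := by
      ext x; simp; omega
    rw [this, prod_insert (by simp), hYn, sub_zero]
    congr 1
    refine prod_congr rfl fun j hj => ?_
    rw [hYi j (mem_of_mem_erase hj)]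
  rw [hYi i hi, this, e2, prod_div_distrib]
  have := h0 i
  rw [mul_right_comm, mul_comm _ (X i), mul_div_mul_left _ _ this]
  ring

def xc (μ : YoungDiagram) (i : ℕ) : ℤ := (μ.rowLen i : ℤ) - i

def Cor (μ : YoungDiagram) (r : ℕ) : Prop := μ.rowLen (r + 1) < μ.rowLen r

open Classical in
noncomputable def remCell (μ : YoungDiagram) (r : ℕ) : YoungDiagram :=
  if h : Cor μ r then
    ⟨μ.cells.erase (r, μ.rowLen r - 1), by
      rintro ⟨i, j⟩ ⟨i', j'⟩ hle hm
      obtain ⟨h1, h2⟩ := Prod.mk_le_mk.1 hle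
      simp only [coe_erase, Set.mem_sdiff, mem_coe, YoungDiagram.mem_cells, Set.mem_singleton_iff,
        Prod.mk.injEq] at hm ⊢
      refine ⟨μ.up_left_mem h1 h2 hm.1, ?_⟩
      rintro ⟨rfl, rfl⟩
      have h3 := YoungDiagram.mem_iff_lt_rowLen.1 hm.1
      unfold Cor at h
      rcases h1.eq_or_lt with e | e
      · subst e; exact hm.2 ⟨rfl, by omega⟩
      · have := μ.rowLen_anti _ _ (Nat.succ_le_of_lt e)
        simp only [Nat.succ_eq_add_one] at this
        omega⟩
  else ⊥

lemma remCell_cells {μ : YoungDiagram} {r : ℕ} (h : Cor μ r) :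
    (remCell μ r).cells = μ.cells.erase (r, μ.rowLen r - 1) := by
  simp [remCell, h]

lemma rowLen_unique {μ : YoungDiagram} {i m : ℕ} (h : ∀ j, (i, j) ∈ μ ↔ j < m) :
    μ.rowLen i = m := by
  apply le_antisymm
  · by_contra! hc
    have := YoungDiagram.mem_iff_lt_rowLen.2 hc
    rw [h] at this; omega
  · by_contra! hc
    have := (h _).2 hc
    rw [YoungDiagram.mem_iff_lt_rowLen] at this; omega

lemma colLen_unique {μ : YoungDiagram} {j m : ℕ} (h : ∀ i, (i, j) ∈ μ ↔ i < m) :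
    μ.colLen j = m := by
  apply le_antisymm
  · by_contra! hc
    have := YoungDiagram.mem_iff_lt_colLen.2 hc
    rw [h] at this; omega
  · by_contra! hc
    have := (h _).2 hc
    rw [YoungDiagram.mem_iff_lt_colLen] at this; omega

lemma lt_row_iff_lt_col {μ : YoungDiagram} {i j : ℕ} : j < μ.rowLen i ↔ i < μ.colLen j := by
  rw [← YoungDiagram.mem_iff_lt_colLen, YoungDiagram.mem_iff_lt_rowLen]

lemma mem_remCell {μ : YoungDiagram} {r s : ℕ} (h : Cor μ r) (hs : μ.rowLen r = s + 1)
    (c : ℕ × ℕ) : c ∈ remCell μ r ↔ c ∈ μ ∧ c ≠ (r, s) := by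
  rw [← YoungDiagram.mem_cells, remCell_cells h, hs]
  simp [and_comm]

lemma colLen_corner {μ : YoungDiagram} {r s : ℕ} (h : Cor μ r) (hs : μ.rowLen r = s + 1) :
    μ.colLen s = r + 1 := by
  unfold Cor at h
  have h1 : r < μ.colLen s := lt_row_iff_lt_col.1 (by omega)
  have h2 : ¬ (r + 1 < μ.colLen s) := fun h' => by
    have := lt_row_iff_lt_col.2 h'; omega
  omega

lemma rowLen_rem {μ : YoungDiagram} {r s : ℕ} (h : Cor μ r) (hs : μ.rowLen r = s + 1) (i : ℕ) :
    (remCell μ r).rowLen i = if i = r then s else μ.rowLen i := by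
  apply rowLen_unique
  intro j
  rw [mem_remCell h hs, YoungDiagram.mem_iff_lt_rowLen]
  split_ifs with e
  · subst e; simp; omega
  · simp [e]

lemma colLen_rem {μ : YoungDiagram} {r s : ℕ} (h : Cor μ r) (hs : μ.rowLen r = s + 1) (j : ℕ) :
    (remCell μ r).colLen j = if j = s then r else μ.colLen j := by
  apply colLen_unique
  intro i
  have := colLen_corner h hs
  rw [mem_remCell h hs, YoungDiagram.mem_iff_lt_colLen]
  split_ifs with e
  · subst e; simp; omega
  · simp [e]

lemma tele_up {K : Type*} [Field K] (f : ℕ → K) (a b : ℕ) (hab : a ≤ b)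
    (hf : ∀ k, a ≤ k → k ≤ b → f k ≠ 0) :
    ∏ k ∈ Ico (a + 1) (b + 1), f k / f (k - 1) = f b / f a := by
  induction b, hab using Nat.le_induction with
  | base => simp [hf a le_rfl le_rfl]
  | succ b hb ih =>
    rw [prod_Ico_succ_top (by omega), ih fun k h1 h2 => hf k h1 (by omega)]
    have := hf b hb (by omega)
    simp; field_simp

lemma tele_down {K : Type*} [Field K] (f : ℕ → K) (m : ℕ)
    (hf : ∀ k, k ≤ m → f k ≠ 0) :
    ∏ k ∈ range m, f k / f (k + 1) = f 0 / f m := by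
  induction m with
  | zero => simp [hf 0 le_rfl]
  | succ b ih =>
    rw [prod_range_succ, ih fun k h2 => hf k (by omega)]
    have := hf b (by omega)
    field_simp

section
variable {K : Type*} [Field K] (t : K)

lemma prod_cols_rows (ht : ∀ k : ℤ, k ≠ 0 → brk t k ≠ 0)
    {μ : YoungDiagram} {r s : ℕ} (h : Cor μ r) (hs : μ.rowLen r = s + 1) :
    ∏ j ∈ range s, brk t ((s : ℤ) - r - j + μ.colLen j) / brk t ((s : ℤ) - r - j + μ.colLen j - 1)
    = brk t ((s : ℤ) - r + μ.colLen 0) / brk t 1 *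
      ∏ i ∈ Ico (r + 1) (μ.colLen 0),
        brk t ((s : ℤ) - r + i - μ.rowLen i) / brk t ((s : ℤ) - r + i - μ.rowLen i + 1) := by
  let φ : ℤ → K := fun u => brk t (u + 1) / brk t u
  have hφ : ∀ u : ℤ, 1 ≤ u → φ u ≠ 0 := fun u hu =>
    div_ne_zero (ht _ (by omega)) (ht _ (by omega))
  have hn : r < μ.colLen 0 := lt_row_iff_lt_col.1 (by omega)
  have hrow : ∀ i, r + 1 ≤ i → μ.rowLen i ≤ s := fun i hi => by
    have := μ.rowLen_anti _ _ hi
    unfold Cor at h; omega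
  have hcol : ∀ j, j < s → r + 1 ≤ μ.colLen j := fun j hj =>
    lt_row_iff_lt_col.1 (by omega)
  have E : ∏ j ∈ range s, ∏ i ∈ Ico (r + 1) (μ.colLen j),
        φ ((s : ℤ) - r - j + i) / φ ((s : ℤ) - r - j + i - 1)
      = ∏ i ∈ Ico (r + 1) (μ.colLen 0), ∏ j ∈ range (μ.rowLen i),
        φ ((s : ℤ) - r - j + i) / φ ((s : ℤ) - r - j + i - 1) := by
    apply prod_comm'
    intro j i
    simp only [mem_range, mem_Ico]
    constructor
    · rintro ⟨h1, h2, h3⟩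
      exact ⟨lt_row_iff_lt_col.2 h3, h2, h3.trans_le (μ.colLen_anti _ _ (Nat.zero_le _))⟩
    · rintro ⟨h1, h2, h3⟩
      exact ⟨h1.trans_le (hrow i h2), h2, lt_row_iff_lt_col.1 h1⟩
  have C : ∀ j ∈ range s, ∏ i ∈ Ico (r + 1) (μ.colLen j),
        φ ((s : ℤ) - r - j + i) / φ ((s : ℤ) - r - j + i - 1)
      = (brk t ((s : ℤ) - r - j + μ.colLen j) / brk t ((s : ℤ) - r - j + μ.colLen j - 1))
        / φ ((s : ℤ) - j) := by
    intro j hj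
    rw [mem_range] at hj
    obtain ⟨b, hb⟩ : ∃ b, μ.colLen j = b + 1 := ⟨μ.colLen j - 1, by have := hcol j hj; omega⟩
    have hbr := hcol j hj
    have := tele_up (fun i : ℕ => φ ((s : ℤ) - r - j + i)) r b (by omega)
      (fun k h1 h2 => hφ _ (by omega))
    rw [hb]
    refine Eq.trans (prod_congr rfl fun i hi => ?_) (this.trans ?_)
    · rw [mem_Ico] at hi
      congr 2
      push_cast [Nat.cast_sub (show 1 ≤ i by omega)]; ring
    · congr 1
      · simp only [φ]
        congr 2 <;> push_cast <;> ring
      · congr 1; ring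
  have R : ∀ i ∈ Ico (r + 1) (μ.colLen 0), ∏ j ∈ range (μ.rowLen i),
        φ ((s : ℤ) - r - j + i) / φ ((s : ℤ) - r - j + i - 1)
      = φ ((s : ℤ) - r + i) * (brk t ((s : ℤ) - r + i - μ.rowLen i) /
          brk t ((s : ℤ) - r + i - μ.rowLen i + 1)) := by
    intro i hi
    rw [mem_Ico] at hi
    have h1 := hrow i hi.1
    have := tele_down (fun j : ℕ => φ ((s : ℤ) - r - j + i)) (μ.rowLen i)
      (fun k h2 => hφ _ (by omega))
    refine Eq.trans (prod_congr rfl fun j hj => ?_) (this.trans ?_)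
    · congr 2
      push_cast; ring
    · rw [div_eq_mul_inv]
      congr 1
      · congr 1; simp
      · simp only [φ]
        rw [inv_div]
        congr 2 <;> ring
  rw [prod_congr rfl C, prod_congr rfl R, prod_div_distrib, prod_mul_distrib] at E
  have S1 : ∏ j ∈ range s, φ ((s : ℤ) - j) = brk t (s + 1) / brk t 1 := by
    have := tele_down (fun j : ℕ => brk t ((s : ℤ) - j + 1)) s (fun k hk => ht _ (by omega))
    refine Eq.trans (prod_congr rfl fun j hj => ?_) (this.trans ?_)
    · simp only [φ]
      congr 2; push_cast; ring
    · simp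
  have S2 : ∏ i ∈ Ico (r + 1) (μ.colLen 0), φ ((s : ℤ) - r + i)
      = brk t ((s : ℤ) - r + μ.colLen 0) / brk t (s + 1) := by
    obtain ⟨b, hb⟩ : ∃ b, μ.colLen 0 = b + 1 := ⟨μ.colLen 0 - 1, by omega⟩
    rw [hb]
    have := tele_up (fun i : ℕ => brk t ((s : ℤ) - r + i + 1)) r b (by omega)
      (fun k h1 h2 => ht _ (by omega))
    refine Eq.trans (prod_congr rfl fun i hi => ?_) (this.trans ?_)
    · rw [mem_Ico] at hi
      simp only [φ]
      congr 2
      push_cast [Nat.cast_sub (show 1 ≤ i by omega)]; ring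
    · congr 2 <;> push_cast <;> ring
  have b1 := ht 1 one_ne_zero
  have b2 := ht (s + 1) (by omega)
  rw [S1, S2, div_eq_iff (div_ne_zero b2 b1)] at E
  rw [E]
  field_simp

lemma hook_ratio (ht : ∀ k : ℤ, k ≠ 0 → brk t k ≠ 0)
    {μ : YoungDiagram} {r : ℕ} (h : Cor μ r) :
    ∏ c ∈ μ.cells, brk t (hookLen μ c) =
      (brk t (xc μ r - 1 + μ.colLen 0) * ∏ i ∈ (range (μ.colLen 0)).erase r,
        brk t (xc μ r - 1 - xc μ i) / brk t (xc μ r - xc μ i)) *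
      ∏ c ∈ (remCell μ r).cells, brk t (hookLen (remCell μ r) c) := by
  obtain ⟨s, hs⟩ : ∃ s, μ.rowLen r = s + 1 := ⟨μ.rowLen r - 1, by unfold Cor at h; omega⟩
  have hcs := colLen_corner h hs
  have hn : r < μ.colLen 0 := lt_row_iff_lt_col.1 (by omega)
  have hrs : (r, s) ∈ μ.cells := by
    rw [YoungDiagram.mem_cells, YoungDiagram.mem_iff_lt_rowLen]; omega
  have hcells : (remCell μ r).cells = μ.cells.erase (r, s) := by
    rw [remCell_cells h, hs]; rfl
  have hh : ∀ c ∈ (remCell μ r).cells, brk t (hookLen (remCell μ r) c) ≠ 0 := fun c _ =>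
    ht _ (by unfold hookLen; omega)
  set A : ℕ → K := fun j => brk t ((s : ℤ) - r - j + μ.colLen j) /
    brk t ((s : ℤ) - r - j + μ.colLen j - 1) with hA
  set B : ℕ → K := fun i => brk t (xc μ r - 1 - xc μ i) / brk t (xc μ r - xc μ i) with hB
  have hxr : xc μ r = s + 1 - r := by simp [xc, hs]
  have hook_rs : hookLen μ (r, s) = 1 := by simp [hookLen, armLen, legLen, hs, hcs]
  let g : ℕ × ℕ → K := fun c => brk t (hookLen μ c) / brk t (hookLen (remCell μ r) c)
  have G : ∏ c ∈ (remCell μ r).cells, g c = (∏ j ∈ range s, A j) * ∏ i ∈ range r, B i := by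
    have hsub : ((range s).image fun j => (r, j)) ∪ ((range r).image fun i => (i, s))
        ⊆ (remCell μ r).cells := by
      intro c hc
      rw [YoungDiagram.mem_cells, mem_remCell h hs]
      simp only [mem_union, mem_image, mem_range] at hc
      rcases hc with ⟨j, hj, rfl⟩ | ⟨i, hi, rfl⟩
      · rw [YoungDiagram.mem_iff_lt_rowLen]; simp; omega
      · rw [YoungDiagram.mem_iff_lt_colLen]; simp; omega
    rw [← prod_subset hsub, prod_union, prod_image, prod_image]
    · congr 1
      · refine prod_congr rfl fun j hj => ?_
        rw [mem_range] at hj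
        have : r < μ.colLen j := lt_row_iff_lt_col.1 (by omega)
        simp only [g, hA, hookLen, armLen, legLen, rowLen_rem h hs, colLen_rem h hs, hs, if_true,
          hj.ne, if_false]
        congr 2 <;> omega
      · refine prod_congr rfl fun i hi => ?_
        rw [mem_range] at hi
        have : s < μ.rowLen i := lt_row_iff_lt_col.2 (by omega)
        simp only [g, hB, hookLen, armLen, legLen, rowLen_rem h hs, colLen_rem h hs, hcs, if_true,
          hi.ne, if_false]
        rw [← neg_div_neg_eq, ← brk_neg, ← brk_neg, hxr]
        unfold xc
        congr 2 <;> omega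
    · intro a _ b _ e; simpa using e
    · intro a _ b _ e; simpa using e
    · rw [disjoint_left]
      intro c h1 h2
      simp only [mem_image, mem_range] at h1 h2
      obtain ⟨j, hj, rfl⟩ := h1
      obtain ⟨i, hi, e⟩ := h2
      simp only [Prod.mk.injEq] at e
      omega
    · rintro ⟨i, j⟩ hc hc2
      have hne := hh _ hc
      have hi : i ≠ r := by
        rintro rfl
        apply hc2
        rw [YoungDiagram.mem_cells, YoungDiagram.mem_iff_lt_rowLen, rowLen_rem h hs] at hc
        simp at hc
        simp [hc]
      have hj : j ≠ s := by
        rintro rfl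
        apply hc2
        rw [YoungDiagram.mem_cells, YoungDiagram.mem_iff_lt_colLen, colLen_rem h hs] at hc
        simp at hc
        simp [hc]
      have : hookLen μ (i, j) = hookLen (remCell μ r) (i, j) := by
        simp [hookLen, armLen, legLen, rowLen_rem h hs, colLen_rem h hs, hi, hj]
      simp only [g, this]
      exact div_self hne
  have hsplit : (range (μ.colLen 0)).erase r = range r ∪ Ico (r + 1) (μ.colLen 0) := by
    ext x; simp; omega
  have hdis : Disjoint (range r) (Ico (r + 1) (μ.colLen 0)) := by
    rw [disjoint_left]; intro x; simp; omega
  rw [← mul_prod_erase _ _ hrs, hook_rs, ← hcells, hsplit, prod_union hdis]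
  have G2 : ∏ c ∈ (remCell μ r).cells, brk t (hookLen μ c) = (∏ c ∈ (remCell μ r).cells, g c) *
      ∏ c ∈ (remCell μ r).cells, brk t (hookLen (remCell μ r) c) := by
    rw [← prod_mul_distrib]
    exact prod_congr rfl fun c hc => (div_mul_cancel₀ _ (hh c hc)).symm
  rw [G2, G, prod_cols_rows t ht h hs]
  have e3 : ∏ i ∈ Ico (r + 1) (μ.colLen 0),
        brk t ((s : ℤ) - r + i - μ.rowLen i) / brk t ((s : ℤ) - r + i - μ.rowLen i + 1)
      = ∏ i ∈ Ico (r + 1) (μ.colLen 0), B i := by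
    refine prod_congr rfl fun i _ => ?_
    simp only [hB, hxr]
    unfold xc
    congr 2 <;> ring
  have b1 := ht 1 one_ne_zero
  have e4 : xc μ r - 1 + μ.colLen 0 = (s : ℤ) - r + μ.colLen 0 := by rw [hxr]; ring
  change _ = (_ * ((∏ i ∈ range r, B i) * ∏ i ∈ Ico (r + 1) (μ.colLen 0), B i)) * _
  rw [e3, e4]
  push_cast
  field_simp

end

section
variable {K : Type*} [Field K] (t : K)

noncomputable def Tfac (μ : YoungDiagram) (r : ℕ) : K :=
  brk t (xc μ r - 1 + μ.colLen 0) * ∏ i ∈ (range (μ.colLen 0)).erase r,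
        brk t (xc μ r - 1 - xc μ i) / brk t (xc μ r - xc μ i)

lemma Tfac_zero {μ : YoungDiagram} {r : ℕ} (hr : r < μ.colLen 0) (h : ¬ Cor μ r) :
    Tfac t μ r = 0 := by
  have h1 := μ.rowLen_anti r (r + 1) (by omega)
  have h2 : 0 < μ.rowLen r := lt_row_iff_lt_col.2 hr
  unfold Cor at h
  have h3 : r + 1 < μ.colLen 0 := lt_row_iff_lt_col.1 (by omega)
  unfold Tfac
  rw [prod_eq_zero (i := r + 1) (by simp; omega), mul_zero]
  have : xc μ r - 1 - xc μ (r + 1) = 0 := by unfold xc; push_cast; omega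
  rw [this]; simp [brk]

lemma xc_lt {μ : YoungDiagram} {i j : ℕ} (h : i < j) : xc μ j < xc μ i := by
  have := μ.rowLen_anti i j h.le
  unfold xc; omega

lemma xc_inj {μ : YoungDiagram} : Function.Injective (xc μ) := by
  intro i j h
  rcases lt_trichotomy i j with e | e | e
  · have := xc_lt (μ := μ) e; omega
  · exact e
  · have := xc_lt (μ := μ) e; omega

lemma brk_ratio (ht0 : t ≠ 0) (x y : ℤ) :
    brk t (x - 1 - y) / brk t (x - y)
      = t⁻¹ * ((t ^ (2 * x) - t ^ 2 * t ^ (2 * y)) / (t ^ (2 * x) - t ^ (2 * y))) := by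
  have e1 : brk t (x - y) = t ^ (-(x + y)) * (t ^ (2 * x) - t ^ (2 * y)) := by
    unfold brk
    rw [mul_sub, ← zpow_add₀ ht0, ← zpow_add₀ ht0]
    congr 2 <;> ring
  have e2 : brk t (x - 1 - y) = t ^ (-(x + y)) * (t⁻¹ * (t ^ (2 * x) - t ^ 2 * t ^ (2 * y))) := by
    unfold brk
    rw [← zpow_neg_one, ← zpow_natCast t 2, mul_sub, mul_sub, ← zpow_add₀ ht0, ← zpow_add₀ ht0,
      ← zpow_add₀ ht0, ← zpow_add₀ ht0, ← zpow_add₀ ht0]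
    congr 2 <;> push_cast <;> ring
  rw [e1, e2, mul_div_mul_left _ _ (zpow_ne_zero _ ht0), mul_div_assoc]

lemma row_sum (ht0 : t ≠ 0) (i m : ℕ) :
    (t - t⁻¹) * ∑ j ∈ range m, t ^ (2 * cellContent (i, j))
      = t⁻¹ * (t ^ (2 * ((m : ℤ) - i)) - t ^ (-2 * (i : ℤ))) := by
  induction m with
  | zero => simp
  | succ m ih =>
    rw [sum_range_succ, mul_add, ih]
    have : t ^ (2 * (((m + 1 : ℕ) : ℤ) - i)) = t ^ (2 * ((m : ℤ) - i)) * t ^ 2 := by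
      rw [← zpow_natCast t 2, ← zpow_add₀ ht0]; congr 1; push_cast; ring
    rw [this]
    simp only [cellContent]
    field_simp
    ring

lemma sum_id (ht0 : t ≠ 0) (ht : ∀ k : ℤ, k ≠ 0 → brk t k ≠ 0) (μ : YoungDiagram) :
    ∑ i ∈ range (μ.colLen 0), t ^ (xc μ i - 1) * Tfac t μ i
      = (t - t⁻¹) * ∑ c ∈ μ.cells, t ^ (2 * cellContent c) := by
  set n := μ.colLen 0 with hn
  set X : ℕ → K := fun i => t ^ (2 * xc μ i) with hX
  have hpow : ∀ k : ℤ, k ≠ 0 → t ^ (2 * k) ≠ 1 := by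
    intro k hk e
    apply ht k hk
    unfold brk
    have : t ^ k = t ^ (2 * k) * t ^ (-k) := by rw [← zpow_add₀ ht0]; congr 1; ring
    rw [this, e]; ring
  have hq : t ^ 2 ≠ 1 := by
    have := hpow 1 one_ne_zero
    exact_mod_cast this
  have hXinj : Set.InjOn X (range n) := by
    intro i _ j _ h
    by_contra hne
    have h1 : xc μ i - xc μ j ≠ 0 := fun h2 => hne (xc_inj (sub_eq_zero.1 h2))
    apply hpow _ h1
    simp only [hX] at h
    rw [mul_sub, zpow_sub₀ ht0, h, div_self (zpow_ne_zero _ ht0)]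
  have hX0 : ∀ i, X i ≠ 0 := fun i => zpow_ne_zero _ ht0
  have hA := hl_A n X (t ^ 2) hq hXinj hX0
  have hB := hl_B n X (t ^ 2) hq hXinj
  have term : ∀ i ∈ range n, t ^ (xc μ i - 1) * Tfac t μ i
      = t⁻¹ * (X i * ∏ j ∈ (range n).erase i, (X i - t ^ 2 * X j) / (X i - X j))
       - t ^ (-(2 * (n : ℤ) - 1)) * ∏ j ∈ (range n).erase i, (X i - t ^ 2 * X j) / (X i - X j) := by
    intro i hi
    unfold Tfac
    rw [← hn, prod_congr rfl (fun j _ => brk_ratio t ht0 (xc μ i) (xc μ j)), prod_mul_distrib,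
      prod_const, card_erase_of_mem hi, card_range]
    have hi' := mem_range.1 hi
    have e1 : t⁻¹ ^ (n - 1) = t ^ (-((n : ℤ) - 1)) := by
      rw [zpow_neg, inv_pow, ← zpow_natCast, Nat.cast_sub (by omega)]; simp
    have e2 : t ^ (xc μ i - 1) * (brk t (xc μ i - 1 + n) * t ^ (-((n : ℤ) - 1)))
        = t⁻¹ * X i - t ^ (-(2 * (n : ℤ) - 1)) := by
      simp only [brk, hX]
      rw [sub_mul, mul_sub, ← zpow_neg_one, ← zpow_add₀ ht0, ← zpow_add₀ ht0, ← zpow_add₀ ht0,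
        ← zpow_add₀ ht0, ← zpow_add₀ ht0]
      congr 2 <;> ring
    rw [e1, ← mul_assoc (brk t _), ← mul_assoc (t ^ _), e2]
    ring
  rw [sum_congr rfl term, sum_sub_distrib, ← mul_sum, ← mul_sum, hA, hB]
  rw [sum_finset_product μ.cells (range n) (fun i => range (μ.rowLen i)), mul_sum _ _ (t - t⁻¹),
    sum_congr rfl (fun i _ => row_sum t ht0 i (μ.rowLen i)), ← mul_sum, sum_sub_distrib, mul_sub]
  · congr 1
    rw [← sum_range_reflect, mul_sum, mul_sum]
    refine sum_congr rfl fun i hi => ?_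
    have hi' := mem_range.1 hi
    rw [← pow_mul, ← zpow_natCast, ← zpow_add₀ ht0, ← zpow_neg_one, ← zpow_add₀ ht0]
    congr 1
    push_cast [Nat.cast_sub (show i ≤ n - 1 by omega), Nat.cast_sub (show 1 ≤ n by omega)]
    ring
  · rintro ⟨i, j⟩
    simp only [YoungDiagram.mem_cells, mem_range]
    rw [← YoungDiagram.mem_iff_lt_rowLen]
    refine ⟨fun h => ⟨?_, h⟩, fun h => h.2⟩
    exact YoungDiagram.mem_iff_lt_colLen.1 (μ.up_left_mem le_rfl (Nat.zero_le _) h)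
end

open Classical in
lemma addCell_set_s9 (μ : YoungDiagram) :
    {l : YoungDiagram | AddCell l μ} =
      remCell μ '' ((range (μ.colLen 0)).filter (Cor μ) : Finset ℕ) := by
  ext l
  simp only [Set.mem_ofPred_eq, Set.mem_image, mem_coe, mem_filter, mem_range]
  constructor
  · rintro ⟨hsub, hcard⟩
    have h1 : (μ.cells \ l.cells).card = 1 := by
      rw [card_sdiff_of_subset hsub]
      simp only [YoungDiagram.card] at hcard
      omega
    obtain ⟨⟨i, j⟩, hij⟩ := card_eq_one.1 h1
    have hm : ∀ c, c ∈ μ → c ∉ l → c = (i, j) := fun c h1 h2 => by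
      have : c ∈ μ.cells \ l.cells := by simp [h1, h2]
      rw [hij] at this; simpa using this
    have hijm : (i, j) ∈ μ ∧ (i, j) ∉ l := by
      have : (i, j) ∈ μ.cells \ l.cells := by rw [hij]; simp
      simpa using this
    have hr : (i, j + 1) ∉ μ := fun h => by
      by_cases hl : (i, j + 1) ∈ l
      · exact hijm.2 (l.up_left_mem le_rfl (by omega) hl)
      · have := hm _ h hl; simp at this
    have hd : (i + 1, j) ∉ μ := fun h => by
      by_cases hl : (i + 1, j) ∈ l
      · exact hijm.2 (l.up_left_mem (by omega) le_rfl hl)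
      · have := hm _ h hl; simp at this
    have k1 := YoungDiagram.mem_iff_lt_rowLen.1 hijm.1
    rw [YoungDiagram.mem_iff_lt_rowLen] at hr hd
    have hc : Cor μ i := by unfold Cor; omega
    refine ⟨i, ⟨lt_row_iff_lt_col.1 (by omega), hc⟩, ?_⟩
    apply YoungDiagram.ext
    rw [remCell_cells hc, show μ.rowLen i - 1 = j by omega]
    ext c
    simp only [mem_erase, YoungDiagram.mem_cells]
    constructor
    · rintro ⟨a, b⟩
      by_contra hh
      exact a (hm c b hh)
    · intro hcl
      refine ⟨?_, ?_⟩
      · rintro rfl; exact hijm.2 hcl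
      · have := hsub ((YoungDiagram.mem_cells c).2 hcl)
        simpa using this
  · rintro ⟨r, ⟨hr, hc⟩, rfl⟩
    have hmem : (r, μ.rowLen r - 1) ∈ μ.cells := by
      rw [YoungDiagram.mem_cells, YoungDiagram.mem_iff_lt_rowLen]
      unfold Cor at hc; omega
    refine ⟨?_, ?_⟩
    · rw [remCell_cells hc]; exact erase_subset _ _
    · unfold YoungDiagram.card
      rw [remCell_cells hc, card_erase_add_one hmem]

lemma remCell_sdiff {μ : YoungDiagram} {r : ℕ} (hc : Cor μ r) :
    μ.cells \ (remCell μ r).cells = {(r, μ.rowLen r - 1)} := by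
  have hmem : (r, μ.rowLen r - 1) ∈ μ.cells := by
    rw [YoungDiagram.mem_cells, YoungDiagram.mem_iff_lt_rowLen]
    unfold Cor at hc; omega
  rw [remCell_cells hc, sdiff_erase_self hmem]

lemma newContent_rem {μ : YoungDiagram} {r : ℕ} (hc : Cor μ r) :
    newContent (remCell μ r) μ = xc μ r - 1 := by
  unfold newContent
  rw [remCell_sdiff hc, sum_singleton]
  unfold Cor at hc
  simp only [cellContent, xc]
  omega

lemma vt_ne : vt ≠ 0 := RatFunc.X_ne_zero

lemma vt_pow_ne (n : ℕ) (hn : n ≠ 0) : vt ^ n ≠ 1 := by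
  intro h
  have h2 : (algebraMap (Polynomial (RatFunc ℚ)) F2) (Polynomial.X ^ n) =
      algebraMap (Polynomial (RatFunc ℚ)) F2 1 := by
    rw [map_pow, RatFunc.algebraMap_X, map_one]; exact h
  have h3 := RatFunc.algebraMap_injective _ h2
  have h4 := congrArg Polynomial.natDegree h3
  rw [Polynomial.natDegree_X_pow, Polynomial.natDegree_one] at h4
  exact hn h4

lemma vt_brk (k : ℤ) (hk : k ≠ 0) : brk vt k ≠ 0 := by
  have pos : ∀ n : ℕ, n ≠ 0 → brk vt (n : ℤ) ≠ 0 := by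
    intro n hn h
    unfold brk at h
    apply vt_pow_ne (2 * n) (by omega)
    rw [sub_eq_zero, zpow_neg, zpow_natCast] at h
    have := pow_ne_zero n vt_ne
    rw [two_mul, pow_add]
    nth_rewrite 1 [h]
    exact inv_mul_cancel₀ this
  rcases Int.natAbs_eq k with e | e
  · rw [e]; exact pos _ (by omega)
  · rw [e, brk_neg]; exact neg_ne_zero.2 (pos _ (by omega))

lemma psi_eq (γ : F2) (l : YoungDiagram) :
    psiUnknot γ l = γ ^ l.card *
      ((∏ c ∈ l.cells, (va * vt ^ (-cellContent c) - va⁻¹ * vt ^ cellContent c)) /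
        ∏ c ∈ l.cells, brk vt (hookLen l c)) := by
  unfold psiUnknot
  rw [prod_div_distrib]
  rfl

lemma psi_term (γ : F2) {μ : YoungDiagram} {r : ℕ} (hc : Cor μ r) :
    γ * ((va - va⁻¹ * vt ^ (2 * newContent (remCell μ r) μ)) * psiUnknot γ (remCell μ r))
      = (vt ^ (xc μ r - 1) * Tfac vt μ r) * psiUnknot γ μ := by
  have hmem : (r, μ.rowLen r - 1) ∈ μ.cells := by
    rw [YoungDiagram.mem_cells, YoungDiagram.mem_iff_lt_rowLen]
    unfold Cor at hc; omega
  have hcard : μ.card = (remCell μ r).card + 1 := by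
    unfold YoungDiagram.card
    rw [remCell_cells hc, card_erase_add_one hmem]
  have hcc : cellContent (r, μ.rowLen r - 1) = xc μ r - 1 := by
    have := newContent_rem hc
    unfold newContent at this
    rwa [remCell_sdiff hc, sum_singleton] at this
  have hH := hook_ratio vt vt_brk hc
  have hne : ∏ c ∈ μ.cells, brk vt (hookLen μ c) ≠ 0 :=
    prod_ne_zero_iff.2 fun c _ => vt_brk _ (by unfold hookLen; omega)
  change _ = Tfac vt μ r * _ at hH
  rw [psi_eq, psi_eq, newContent_rem hc, hcard, hH, ← mul_prod_erase _ _ hmem, ← remCell_cells hc,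
    hcc]
  rw [hH] at hne
  have hT := left_ne_zero_of_mul hne
  have hR := right_ne_zero_of_mul hne
  generalize ∏ c ∈ (remCell μ r).cells, brk vt (hookLen (remCell μ r) c) = R at *
  generalize ∏ c ∈ (remCell μ r).cells,
    (va * vt ^ (-cellContent c) - va⁻¹ * vt ^ cellContent c) = N at *
  generalize Tfac vt μ r = T at *
  generalize xc μ r - 1 = x at *
  have e : va - va⁻¹ * vt ^ (2 * x) = vt ^ x * (va * vt ^ (-x) - va⁻¹ * vt ^ x) := by
    have e1 : vt ^ x * vt ^ (-x) = 1 := by rw [← zpow_add₀ vt_ne]; simp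
    have e2 : vt ^ (2 * x) = vt ^ x * vt ^ x := by rw [← zpow_add₀ vt_ne]; congr 1; ring
    rw [e2]
    linear_combination (-va) * e1
  rw [e]
  generalize va * vt ^ (-x) - va⁻¹ * vt ^ x = M
  generalize vt ^ x = V
  rw [pow_succ]
  field_simp

/-- The hook-content function `ψ` solves the skein-valued recursion for the unknot
conormal, in the basis `W_λ`: `ψ_∅ = 1` and for every nonempty `μ`,
`(t - t⁻¹)·C_μ(t)·ψ_μ = γ·Σ_{λ+□=μ} (a - a⁻¹ t^{2c(μ∖λ)})·ψ_λ`. -/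
theorem unknot_recursion_solution (γ : F2) :
    psiUnknot γ ⊥ = 1 ∧
    ∀ μ : YoungDiagram, μ.cells.Nonempty →
      (vt - vt⁻¹) * contentPolyT2 μ * psiUnknot γ μ =
        γ * ∑ᶠ l ∈ {l : YoungDiagram | AddCell l μ},
          (va - va⁻¹ * vt ^ (2 * newContent l μ)) * psiUnknot γ l := by
  classical
  refine ⟨by simp [psiUnknot, YoungDiagram.card], fun μ _ => ?_⟩
  have hinj : Set.InjOn (remCell μ) ((range (μ.colLen 0)).filter (Cor μ) : Finset ℕ) := by
    intro i hi j hj h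
    simp only [coe_filter, Set.mem_ofPred_eq] at hi hj
    have h1 := remCell_sdiff hi.2
    rw [h, remCell_sdiff hj.2] at h1
    simp at h1
    exact h1.1.symm
  rw [addCell_set_s9, finsum_mem_image hinj, finsum_mem_coe_finset, mul_sum,
    sum_congr rfl (fun r hr => psi_term γ (mem_filter.1 hr).2), ← sum_mul]
  congr 1
  unfold contentPolyT2
  rw [← sum_id vt vt_ne vt_brk μ]
  symm
  apply sum_subset (filter_subset _ _)
  intro r hr hr2
  rw [Tfac_zero vt (mem_range.1 hr) (fun h => hr2 (mem_filter.2 ⟨hr, h⟩)), mul_zero]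
end
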